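/- (Theorem 2.) Let ψ_1, …, ψ_n be unit vectors in ℂ^d with probability weights p_i ≥ 0 summing to 1 and Π_i = |ψ_i⟩⟨ψ_i|. The following are equivalent: (1) the ensemble is a generalized 2-design, i.e. Σ_i p_i (Π_i ⊗ Π_i) = (1/(d(d+1)))·(I + SWAP); (2) for every finite POVM {E_b} and every family of density matrices {σ_b}, the average fidelity satisfies Σ_{b,i} p_i · Tr(Π_i E_b) · Tr(Π_i σ_b) ≤ 2/(d+1). -/

import Mathlib

open Matrix Kronecker BigOperators
open scoped ComplexOrder

/-- The rank-one projector `|ψ⟩⟨ψ|` onto a vector `ψ ∈ ℂ^d`. -/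
noncomputable def proj {d : ℕ} (ψ : Fin d → ℂ) : Matrix (Fin d) (Fin d) ℂ :=
  vecMulVec ψ (star ψ)

/-- The swap operator on `ℂ^d ⊗ ℂ^d`, mapping `u ⊗ v` to `v ⊗ u`. -/
def swapMatrix (d : ℕ) : Matrix (Fin d × Fin d) (Fin d × Fin d) ℂ :=
  Matrix.of fun p q => if p.1 = q.2 ∧ p.2 = q.1 then 1 else 0

theorem trace_proj_mul {d : ℕ} (ψ : Fin d → ℂ) (M : Matrix (Fin d) (Fin d) ℂ) :
    (proj ψ * M).trace = star ψ ⬝ᵥ M *ᵥ ψ := by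
  rw [proj, vecMulVec_mul, trace_vecMulVec, dotProduct_comm, dotProduct_mulVec]

theorem trace_proj_mul_proj {d : ℕ} (ψ χ : Fin d → ℂ) :
    (proj ψ * proj χ).trace.re = Complex.normSq (star χ ⬝ᵥ ψ) := by
  rw [trace_proj_mul, proj, vecMulVec_mulVec, ← Complex.ofReal_re (Complex.normSq _),
    Complex.normSq_eq_conj_mul_self, dotProduct_smul, op_smul_eq_smul, smul_eq_mul, mul_comm]
  congr 2
  rw [star_dotProduct, ← starRingEnd_apply, dotProduct_comm]

theorem trace_proj {d : ℕ} (ψ : Fin d → ℂ) : (proj ψ).trace = star ψ ⬝ᵥ ψ := by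
  rw [proj, trace_vecMulVec, dotProduct_comm]

theorem posSemidef_proj {d : ℕ} (ψ : Fin d → ℂ) : (proj ψ).PosSemidef :=
  posSemidef_vecMulVec_self_star ψ

theorem trace_proj_mul_im {d : ℕ} (ψ : Fin d → ℂ) {M : Matrix (Fin d) (Fin d) ℂ}
    (hM : M.PosSemidef) : (proj ψ * M).trace.im = 0 := by
  rw [trace_proj_mul]
  exact (Complex.nonneg_iff.mp (hM.dotProduct_mulVec_nonneg ψ)).2.symm

attribute [local instance] Matrix.frobeniusSeminormedAddCommGroup in
theorem trace_conjTranspose_mul_self_re {d : ℕ} (A : Matrix (Fin d) (Fin d) ℂ) :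
    (Aᴴ * A).trace.re = ‖A‖ ^ 2 := by
  rw [frobenius_norm_def, ← Real.sqrt_eq_rpow, Real.sq_sqrt (by positivity), Finset.sum_comm]
  simp [trace, mul_apply, ← Complex.normSq_eq_conj_mul_self, Complex.normSq_eq_norm_sq]
  simp [← Complex.ofReal_pow]

attribute [local instance] Matrix.frobeniusSeminormedAddCommGroup in
open scoped MatrixOrder in
theorem Matrix.PosSemidef.trace_mul_re_le {d : ℕ} {A B : Matrix (Fin d) (Fin d) ℂ}
    (hA : A.PosSemidef) (hB : B.PosSemidef) :
    (A * B).trace.re ≤ A.trace.re * B.trace.re := by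
  obtain ⟨C, rfl⟩ := CStarAlgebra.nonneg_iff_eq_star_mul_self.mp hA.nonneg
  obtain ⟨D, rfl⟩ := CStarAlgebra.nonneg_iff_eq_star_mul_self.mp hB.nonneg
  simp only [star_eq_conjTranspose]
  have h : (Cᴴ * C * (Dᴴ * D)).trace = ((C * Dᴴ)ᴴ * (C * Dᴴ)).trace := by
    rw [conjTranspose_mul, conjTranspose_conjTranspose, ← Matrix.mul_assoc, Matrix.trace_mul_comm]
    simp only [Matrix.mul_assoc]
  rw [h, trace_conjTranspose_mul_self_re, trace_conjTranspose_mul_self_re,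
    trace_conjTranspose_mul_self_re, ← mul_pow]
  gcongr
  simpa using frobenius_norm_mul C Dᴴ

theorem trace_swapMatrix_mul_kronecker {d : ℕ} (A B : Matrix (Fin d) (Fin d) ℂ) :
    (swapMatrix d * (A ⊗ₖ B)).trace = (A * B).trace := by
  have h : ∀ q : Fin d × Fin d, (swapMatrix d * (A ⊗ₖ B)) q q = A q.2 q.1 * B q.1 q.2 := by
    intro q
    rw [mul_apply, Finset.sum_eq_single (q.2, q.1)]
    · simp [swapMatrix]
    · rintro ⟨a, b⟩ - hab
      have : ¬(q.1 = b ∧ q.2 = a) := fun h => hab (by rw [h.1, h.2])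
      simp [swapMatrix, this]
    · simp
  rw [trace, trace, Fintype.sum_prod_type_right]
  exact Finset.sum_congr rfl fun a _ => by simp only [diag_apply, h, mul_apply]

/-- No strategy has average fidelity above `2 / (d + 1)` on the ensemble `(ψ, p)`. -/
def MinimallyQuantum {d n : ℕ} (ψ : Fin n → Fin d → ℂ) (p : Fin n → ℝ) : Prop :=
  ∀ (m : ℕ) (E : Fin m → Matrix (Fin d) (Fin d) ℂ)
      (σ : Fin m → Matrix (Fin d) (Fin d) ℂ),
    (∀ b, (E b).PosSemidef) → (∑ b, E b = 1) →
    (∀ b, (σ b).PosSemidef) → (∀ b, (σ b).trace = 1) →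
    ∑ b, ∑ i, p i * (proj (ψ i) * E b).trace.re * (proj (ψ i) * σ b).trace.re ≤
      2 / ((d : ℝ) + 1)

theorem sum_mul_trace_proj_mul_trace_proj_of_design {d n : ℕ} {ψ : Fin n → Fin d → ℂ}
    {p : Fin n → ℝ}
    (h : ∑ i, (p i : ℂ) • (proj (ψ i) ⊗ₖ proj (ψ i)) =
        (1 / ((d : ℂ) * (d + 1))) • (1 + swapMatrix d))
    {E : Matrix (Fin d) (Fin d) ℂ} (hE : E.PosSemidef) (σ : Matrix (Fin d) (Fin d) ℂ) :
    ∑ i, p i * (proj (ψ i) * E).trace.re * (proj (ψ i) * σ).trace.re =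
      1 / ((d : ℝ) * (d + 1)) * (E.trace.re * σ.trace.re + (E * σ).trace.re) := by
  have key := congrArg (fun S => (S * (E ⊗ₖ σ)).trace.re) h
  have h1 : (1 / ((d : ℂ) * (d + 1))) = ((1 / ((d : ℝ) * (d + 1)) : ℝ) : ℂ) := by push_cast; rfl
  have hEi : E.trace.im = 0 := (Complex.nonneg_iff.mp hE.trace_nonneg).2.symm
  simp only [Finset.sum_mul, smul_mul, trace_sum, trace_smul, ← mul_kronecker_mul,
    trace_kronecker, add_mul, trace_add, one_mul, trace_swapMatrix_mul_kronecker, h1, smul_eq_mul,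
    Complex.re_sum, Complex.re_ofReal_mul] at key
  simpa only [Complex.mul_re (trace _) (trace _), Complex.add_re, trace_proj_mul_im _ hE, hEi,
    zero_mul, sub_zero, mul_assoc] using key

theorem MinimallyQuantum.of_design {d n : ℕ} (hd : 0 < d) {ψ : Fin n → Fin d → ℂ} {p : Fin n → ℝ}
    (h : ∑ i, (p i : ℂ) • (proj (ψ i) ⊗ₖ proj (ψ i)) =
        (1 / ((d : ℂ) * (d + 1))) • (1 + swapMatrix d)) :
    MinimallyQuantum ψ p := by
  intro m E σ hE hE1 hσ hσ1
  have htr : ∑ b, (E b).trace.re = d := by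
    rw [← Complex.re_sum, ← trace_sum, hE1]; simp
  have hd' : (0 : ℝ) < d := by exact_mod_cast hd
  calc _ = ∑ b, 1 / ((d : ℝ) * (d + 1)) * ((E b).trace.re + (E b * σ b).trace.re) := by
        refine Finset.sum_congr rfl fun b _ => ?_
        rw [sum_mul_trace_proj_mul_trace_proj_of_design h (hE b) (σ b), hσ1 b]; simp
    _ ≤ ∑ b, 1 / ((d : ℝ) * (d + 1)) * ((E b).trace.re + (E b).trace.re) := by
        refine Finset.sum_le_sum fun b _ => mul_le_mul_of_nonneg_left ?_ (by positivity)
        have := (hE b).trace_mul_re_le (hσ b)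
        rw [hσ1 b, Complex.one_re, mul_one] at this
        linarith
    _ = 2 / ((d : ℝ) + 1) := by
        rw [← Finset.mul_sum, Finset.sum_add_distrib, htr]; field_simp; ring

theorem MinimallyQuantum.sum_le {d n : ℕ} {ψ : Fin n → Fin d → ℂ} {p : Fin n → ℝ}
    (h : MinimallyQuantum ψ p) {ι : Type*} [Fintype ι]
    (E σ : ι → Matrix (Fin d) (Fin d) ℂ) (hE : ∀ b, (E b).PosSemidef) (hE1 : ∑ b, E b = 1)
    (hσ : ∀ b, (σ b).PosSemidef) (hσ1 : ∀ b, (σ b).trace = 1) :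
    ∑ b, ∑ i, p i * (proj (ψ i) * E b).trace.re * (proj (ψ i) * σ b).trace.re ≤
      2 / ((d : ℝ) + 1) := by
  let e := (Fintype.equivFin ι).symm
  have := h _ (E ∘ e) (σ ∘ e) (fun b => hE _) ((e.sum_comp E).trans hE1) (fun b => hσ _)
    (fun b => hσ1 _)
  refine le_of_eq_of_le ?_ this
  exact (e.sum_comp fun b =>
    ∑ i, p i * (proj (ψ i) * E b).trace.re * (proj (ψ i) * σ b).trace.re).symm

theorem proj_mulVec {d : ℕ} (U : Matrix (Fin d) (Fin d) ℂ) (ψ : Fin d → ℂ) :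
    proj (U *ᵥ ψ) = U * proj ψ * Uᴴ := by
  rw [proj, proj, mul_vecMulVec, vecMulVec_mul, star_mulVec]

theorem MinimallyQuantum.mulVec {d n : ℕ} {ψ : Fin n → Fin d → ℂ} {p : Fin n → ℝ}
    (h : MinimallyQuantum ψ p) {U : Matrix (Fin d) (Fin d) ℂ} (hU : Uᴴ * U = 1) :
    MinimallyQuantum (fun i => U *ᵥ ψ i) p := by
  intro m E σ hE hE1 hσ hσ1
  have hU' : U * Uᴴ = 1 := mul_eq_one_comm.mp hU
  have htr : ∀ i (M : Matrix (Fin d) (Fin d) ℂ),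
      (proj (U *ᵥ ψ i) * M).trace = (proj (ψ i) * (Uᴴ * M * U)).trace := by
    intro i M
    rw [proj_mulVec, Matrix.mul_assoc, Matrix.mul_assoc, Matrix.trace_mul_comm]
    simp only [Matrix.mul_assoc]
  simp only [htr]
  refine h m _ _ (fun b => (hE b).conjTranspose_mul_mul_same U) ?_
    (fun b => (hσ b).conjTranspose_mul_mul_same U) fun b => ?_
  · rw [← Finset.sum_mul, ← Finset.mul_sum, hE1, Matrix.mul_one, hU]
  · rw [Matrix.trace_mul_cycle, hU', Matrix.one_mul, hσ1 b]

/-- The fourth roots of unity. -/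
noncomputable def quarterPhase : Fin 4 → ℂ := ![1, Complex.I, -1, -Complex.I]

/-- The vector all of whose coordinates are fourth roots of unity, selected by `k`. -/
noncomputable def phaseVec {d : ℕ} (k : Fin d → Fin 4) : Fin d → ℂ := fun a => quarterPhase (k a)

theorem normSq_quarterPhase (j : Fin 4) : Complex.normSq (quarterPhase j) = 1 := by
  fin_cases j <;> simp [quarterPhase]

theorem quarterPhase_add_one (j : Fin 4) :
    quarterPhase (j + 1) = Complex.I * quarterPhase j := by
  fin_cases j <;> simp [quarterPhase]

theorem sum_phaseVec_succ {d : ℕ} (x : Fin (d + 1) → ℂ) (g : ℂ → ℝ) :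
    ∑ k : Fin (d + 1) → Fin 4, g (star (phaseVec k) ⬝ᵥ x) =
      ∑ k : Fin d → Fin 4, ∑ j : Fin 4,
        g (star (quarterPhase j) * x 0 + star (phaseVec k) ⬝ᵥ Fin.tail x) := by
  rw [← (Fin.consEquiv fun _ => Fin 4).sum_comp, Fintype.sum_prod_type_right]
  simp [dotProduct, phaseVec, Fin.sum_univ_succ, Fin.consEquiv, Fin.tail]

theorem sum_normSq_phaseVec_dotProduct {d : ℕ} (x : Fin d → ℂ) :
    ∑ k : Fin d → Fin 4, Complex.normSq (star (phaseVec k) ⬝ᵥ x) =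
      4 ^ d * ∑ a, Complex.normSq (x a) := by
  induction d with
  | zero => simp
  | succ d ih =>
    have step (z w : ℂ) : ∑ j, Complex.normSq (star (quarterPhase j) * z + w) =
        4 * Complex.normSq z + 4 * Complex.normSq w := by
      simp [Fin.sum_univ_four, quarterPhase, Complex.normSq_apply]
      ring
    rw [sum_phaseVec_succ x fun z => Complex.normSq z, Fin.sum_univ_succ]
    simp only [step, Finset.sum_add_distrib, ← Finset.mul_sum, ih]
    simp [Fin.tail]
    ring

theorem sum_normSq_phaseVec_dotProduct_sq {d : ℕ} (x : Fin d → ℂ) :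
    ∑ k : Fin d → Fin 4, Complex.normSq (star (phaseVec k) ⬝ᵥ x) ^ 2 =
      4 ^ d * (2 * (∑ a, Complex.normSq (x a)) ^ 2 - ∑ a, Complex.normSq (x a) ^ 2) := by
  induction d with
  | zero => simp
  | succ d ih =>
    have step (z w : ℂ) : ∑ j, Complex.normSq (star (quarterPhase j) * z + w) ^ 2 =
        4 * Complex.normSq z ^ 2 + 16 * Complex.normSq z * Complex.normSq w +
          4 * Complex.normSq w ^ 2 := by
      simp [Fin.sum_univ_four, quarterPhase, Complex.normSq_apply]
      ring
    rw [sum_phaseVec_succ x fun z => Complex.normSq z ^ 2, Fin.sum_univ_succ, Fin.sum_univ_succ]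
    simp only [step, Finset.sum_add_distrib, ← Finset.mul_sum, ih, sum_normSq_phaseVec_dotProduct]
    simp [Fin.tail]
    ring

theorem sum_proj_phaseVec (d : ℕ) :
    ∑ k : Fin d → Fin 4, proj (phaseVec k) = (4 ^ d : ℂ) • (1 : Matrix (Fin d) (Fin d) ℂ) := by
  ext a b
  simp only [Matrix.sum_apply, proj, vecMulVec_apply, Pi.star_apply, phaseVec,
    Matrix.smul_apply, smul_eq_mul]
  obtain rfl | hab := eq_or_ne a b
  · simp [Complex.mul_conj, normSq_quarterPhase]
  · have h := Equiv.sum_comp (Equiv.addRight (Pi.single a 1 : Fin d → Fin 4))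
      fun k => quarterPhase (k a) * star (quarterPhase (k b))
    simp only [Equiv.coe_addRight, Pi.add_apply, Pi.single_eq_same, quarterPhase_add_one,
      Pi.single_eq_of_ne hab.symm, add_zero, mul_assoc, ← Finset.mul_sum] at h
    rw [one_apply_ne hab, mul_zero]
    have hI : (Complex.I - 1) ≠ 0 := fun h => by simpa using congrArg Complex.im h
    refine (mul_eq_zero.mp ?_).resolve_left hI
    rw [sub_mul, one_mul, h, sub_self]

theorem trace_proj_mul_smul_proj {d : ℕ} (ψ χ : Fin d → ℂ) (c : ℝ) :
    (proj ψ * ((c : ℂ) • proj χ)).trace.re = c * Complex.normSq (star χ ⬝ᵥ ψ) := by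
  rw [Matrix.mul_smul, trace_smul, smul_eq_mul, Complex.re_ofReal_mul, trace_proj_mul_proj]

theorem star_single_dotProduct {d : ℕ} (a : Fin d) (x : Fin d → ℂ) :
    star (Pi.single a 1) ⬝ᵥ x = x a := by
  rw [← Pi.single_star, star_one, single_one_dotProduct]

theorem sum_proj_single (d : ℕ) :
    ∑ b : Fin d, proj (Pi.single b 1) = (1 : Matrix (Fin d) (Fin d) ℂ) := by
  ext a c
  simp [proj, Matrix.sum_apply, vecMulVec_apply, one_apply, Pi.single_apply]

theorem sum_normSq_eq_one {d : ℕ} {x : Fin d → ℂ} (hx : star x ⬝ᵥ x = 1) :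
    ∑ a, Complex.normSq (x a) = 1 := by
  have h : ((∑ a, Complex.normSq (x a) : ℝ) : ℂ) = 1 := by
    rw [← hx]
    simp [dotProduct, Complex.normSq_eq_conj_mul_self]
  exact_mod_cast h

theorem MinimallyQuantum.sum_normSq_apply_le {d n : ℕ} {ψ : Fin n → Fin d → ℂ} {p : Fin n → ℝ}
    (h : MinimallyQuantum ψ p) (hψ : ∀ i, star (ψ i) ⬝ᵥ ψ i = 1) (hp1 : ∑ i, p i = 1)
    (a : Fin d) {χ : Fin d → ℂ} (hχ : star χ ⬝ᵥ χ = 1) :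
    ∑ i, p i * Complex.normSq (ψ i a) * Complex.normSq (star χ ⬝ᵥ ψ i) ≤
      ∑ i, p i * Complex.normSq (ψ i a) ^ 2 := by
  have hd : (0 : ℝ) < d := by exact_mod_cast a.pos
  have hd0 : (d : ℂ) ≠ 0 := by exact_mod_cast hd.ne'
  have hd1 : (d : ℂ) + 1 ≠ 0 := by exact_mod_cast d.succ_ne_zero
  let c : ℝ := d / ((d + 1) * 4 ^ d)
  let E : (Fin d → Fin 4) ⊕ Fin d → Matrix (Fin d) (Fin d) ℂ :=
    Sum.elim (fun k => (c : ℂ) • proj (phaseVec k))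
      fun b => ((1 / (d + 1) : ℝ) : ℂ) • proj (Pi.single b 1)
  let σ : (Fin d → Fin 4) ⊕ Fin d → Matrix (Fin d) (Fin d) ℂ :=
    Sum.elim (fun k => ((1 / d : ℝ) : ℂ) • proj (phaseVec k))
      (Function.update (fun b => proj (Pi.single b 1)) a (proj χ))
  have hsmul {r : ℝ} (hr : 0 ≤ r) (v : Fin d → ℂ) : ((r : ℂ) • proj v).PosSemidef :=
    (posSemidef_proj v).smul (by exact_mod_cast hr)
  have key := h.sum_le E σ ?_ ?_ ?_ ?_
  · have hphase : ∑ k : Fin d → Fin 4, ∑ i, p i * (proj (ψ i) * E (.inl k)).trace.re *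
        (proj (ψ i) * σ (.inl k)).trace.re =
        1 / (d + 1) * (2 - ∑ i, p i * ∑ b, Complex.normSq (ψ i b) ^ 2) := by
      calc _ = ∑ i, 1 / ((d + 1) * 4 ^ d) * p i *
            ∑ k : Fin d → Fin 4, Complex.normSq (star (phaseVec k) ⬝ᵥ ψ i) ^ 2 := by
            rw [Finset.sum_comm]
            refine Finset.sum_congr rfl fun i _ => ?_
            rw [Finset.mul_sum]
            refine Finset.sum_congr rfl fun k _ => ?_
            simp only [E, σ, Sum.elim_inl, trace_proj_mul_smul_proj, c]
            field_simp
        _ = ∑ i, 1 / (d + 1) * (2 * p i - p i * ∑ b, Complex.normSq (ψ i b) ^ 2) := by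
            refine Finset.sum_congr rfl fun i _ => ?_
            rw [sum_normSq_phaseVec_dotProduct_sq, sum_normSq_eq_one (hψ i)]
            field_simp
        _ = _ := by
            rw [← Finset.mul_sum, Finset.sum_sub_distrib, ← Finset.mul_sum, hp1, mul_one]
    have hbasis : ∑ b, ∑ i, p i * (proj (ψ i) * E (.inr b)).trace.re *
        (proj (ψ i) * σ (.inr b)).trace.re =
        1 / (d + 1) * (∑ i, p i * ∑ b, Complex.normSq (ψ i b) ^ 2 +
          (∑ i, p i * Complex.normSq (ψ i a) * Complex.normSq (star χ ⬝ᵥ ψ i) -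
            ∑ i, p i * Complex.normSq (ψ i a) ^ 2)) := by
      have hterm (i : Fin n) (b : Fin d) : p i * (proj (ψ i) * E (.inr b)).trace.re *
          (proj (ψ i) * σ (.inr b)).trace.re = 1 / (d + 1) * (p i * Complex.normSq (ψ i b) ^ 2 +
            if b = a then p i * Complex.normSq (ψ i a) * Complex.normSq (star χ ⬝ᵥ ψ i) -
              p i * Complex.normSq (ψ i a) ^ 2 else 0) := by
        simp only [E, σ, Sum.elim_inr, trace_proj_mul_smul_proj, star_single_dotProduct]
        split_ifs with hb
        · subst hb
          rw [Function.update_self, trace_proj_mul_proj]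
          ring
        · rw [Function.update_of_ne hb, trace_proj_mul_proj, star_single_dotProduct]
          ring
      rw [Finset.sum_comm]
      simp only [hterm, ← Finset.mul_sum, Finset.sum_add_distrib, Finset.sum_ite_eq',
        Finset.mem_univ, if_true, Finset.sum_sub_distrib]
    rw [Fintype.sum_sum_type, hphase, hbasis, ← mul_add, div_eq_mul_one_div 2, mul_comm 2] at key
    have := le_of_mul_le_mul_left key (by positivity)
    linarith
  · rintro (k | b)
    · exact hsmul (by positivity) _
    · exact hsmul (by positivity) _
  · rw [Fintype.sum_sum_type]
    simp only [E, Sum.elim_inl, Sum.elim_inr, ← Finset.smul_sum, sum_proj_phaseVec,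
      sum_proj_single, smul_smul, ← add_smul]
    convert one_smul ℂ _
    simp only [c]
    push_cast
    field_simp
  · rintro (k | b)
    · exact hsmul (by positivity) _
    · simp only [σ, Sum.elim_inr, Function.update_apply]
      split_ifs <;> exact posSemidef_proj _
  · rintro (k | b)
    · simp only [σ, Sum.elim_inl, trace_smul, trace_proj, dotProduct, Pi.star_apply, phaseVec]
      simp [← Complex.normSq_eq_conj_mul_self, normSq_quarterPhase, hd0]
    · simp only [σ, Sum.elim_inr, Function.update_apply]
      split_ifs
      · rw [trace_proj, hχ]
      · rw [trace_proj, star_single_dotProduct, Pi.single_eq_same]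

theorem exists_unitary_mulVec_apply {d : ℕ} (a : Fin d) {φ : Fin d → ℂ}
    (hφ : star φ ⬝ᵥ φ = 1) :
    ∃ U : Matrix (Fin d) (Fin d) ℂ, Uᴴ * U = 1 ∧ ∀ x, (U *ᵥ x) a = star φ ⬝ᵥ x := by
  have hnorm : ‖WithLp.toLp 2 φ‖ = 1 := by
    rw [EuclideanSpace.norm_eq, Real.sqrt_eq_one]
    simpa [Complex.normSq_eq_norm_sq] using sum_normSq_eq_one hφ
  have hv : Orthonormal ℂ (({a} : Set (Fin d)).domRestrict fun _ => WithLp.toLp 2 φ) :=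
    ⟨fun _ => hnorm, fun i j hij => (hij (Subsingleton.elim i j)).elim⟩
  obtain ⟨b, hb⟩ := hv.exists_orthonormalBasis_extension_of_card_eq (by simp)
  refine ⟨Matrix.of fun i j => star (b i j), mul_eq_one_comm.mp ?_, fun x => ?_⟩
  · ext i j
    have := orthonormal_iff_ite.mp b.orthonormal i j
    rw [PiLp.inner_apply] at this
    simpa [mul_apply, one_apply, mul_comm] using this
  · simp [mulVec, dotProduct, hb a rfl]

theorem MinimallyQuantum.sum_normSq_dotProduct_le {d n : ℕ} {ψ : Fin n → Fin d → ℂ}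
    {p : Fin n → ℝ} (h : MinimallyQuantum ψ p) (hψ : ∀ i, star (ψ i) ⬝ᵥ ψ i = 1)
    (hp1 : ∑ i, p i = 1) {φ χ : Fin d → ℂ} (hφ : star φ ⬝ᵥ φ = 1) (hχ : star χ ⬝ᵥ χ = 1) :
    ∑ i, p i * Complex.normSq (star φ ⬝ᵥ ψ i) * Complex.normSq (star χ ⬝ᵥ ψ i) ≤
      ∑ i, p i * Complex.normSq (star φ ⬝ᵥ ψ i) ^ 2 := by
  obtain ⟨a⟩ : Nonempty (Fin d) := by
    by_contra hd
    rw [not_nonempty_iff] at hd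
    simp at hφ
  obtain ⟨U, hU, hUa⟩ := exists_unitary_mulVec_apply a hφ
  have hstar (x y : Fin d → ℂ) : star (U *ᵥ x) ⬝ᵥ U *ᵥ y = star x ⬝ᵥ y := by
    rw [star_mulVec, dotProduct_mulVec, vecMul_vecMul, hU, vecMul_one]
  simpa only [hUa, hstar] using (h.mulVec hU).sum_normSq_apply_le
    (fun i => (hstar _ _).trans (hψ i)) hp1 a ((hstar χ χ).trans hχ)

theorem star_dotProduct_self_eq {d : ℕ} (u : Fin d → ℂ) :
    star u ⬝ᵥ u = ((∑ a, Complex.normSq (u a) : ℝ) : ℂ) := by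
  simp [dotProduct, Complex.normSq_eq_conj_mul_self]

theorem exists_star_dotProduct_self_eq_one {d : ℕ} {u : Fin d → ℂ} (hu : u ≠ 0) :
    ∃ v : Fin d → ℂ, star v ⬝ᵥ v = 1 ∧ ∀ x, Complex.normSq (u ⬝ᵥ x) =
      (∑ a, Complex.normSq (u a)) * Complex.normSq (star v ⬝ᵥ x) := by
  set N := ∑ a, Complex.normSq (u a) with hN
  have hN0 : 0 < N := by
    obtain ⟨a, ha⟩ := Function.ne_iff.mp hu
    exact Finset.sum_pos' (fun _ _ => Complex.normSq_nonneg _)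
      ⟨a, Finset.mem_univ a, Complex.normSq_pos.mpr ha⟩
  refine ⟨((√N)⁻¹ : ℂ) • star u, ?_, fun x => ?_⟩
  · have hs : ((√N : ℝ) : ℂ) * √N = N := by exact_mod_cast Real.mul_self_sqrt hN0.le
    have hs0 : ((√N : ℝ) : ℂ) ≠ 0 := by exact_mod_cast (Real.sqrt_pos.mpr hN0).ne'
    rw [star_smul, star_star, smul_dotProduct, dotProduct_smul, dotProduct_comm,
      star_dotProduct_self_eq, ← hN, ← hs]
    simp
    field_simp
  · rw [star_smul, star_star, smul_dotProduct, smul_eq_mul, Complex.normSq_mul]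
    have : Complex.normSq (star ((√N : ℂ)⁻¹)) = N⁻¹ := by
      simp [Complex.normSq_ofReal, Real.mul_self_sqrt hN0.le]
    rw [this]
    field_simp

theorem MinimallyQuantum.sum_normSq_mul_le {d n : ℕ} {ψ : Fin n → Fin d → ℂ}
    {p : Fin n → ℝ} (h : MinimallyQuantum ψ p) (hψ : ∀ i, star (ψ i) ⬝ᵥ ψ i = 1)
    (hp1 : ∑ i, p i = 1) (u v : Fin d → ℂ) :
    (∑ a, Complex.normSq (u a)) *
        ∑ i, p i * Complex.normSq (u ⬝ᵥ ψ i) * Complex.normSq (v ⬝ᵥ ψ i) ≤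
      (∑ a, Complex.normSq (v a)) * ∑ i, p i * Complex.normSq (u ⬝ᵥ ψ i) ^ 2 := by
  obtain rfl | hu := eq_or_ne u 0
  · simp
  obtain rfl | hv := eq_or_ne v 0
  · simp
  obtain ⟨φ, hφ, hu'⟩ := exists_star_dotProduct_self_eq_one hu
  obtain ⟨χ, hχ, hv'⟩ := exists_star_dotProduct_self_eq_one hv
  simp only [hu', hv']
  have key := mul_le_mul_of_nonneg_left (h.sum_normSq_dotProduct_le hψ hp1 hφ hχ)
    (mul_nonneg (sq_nonneg (∑ a, Complex.normSq (u a)))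
      (Finset.univ.sum_nonneg fun a _ => Complex.normSq_nonneg (v a)))
  generalize ∑ a, Complex.normSq (u a) = S at key ⊢
  generalize ∑ a, Complex.normSq (v a) = T at key ⊢
  refine (Eq.trans_le ?_ key).trans_eq ?_ <;> simp only [Finset.mul_sum] <;>
    exact Finset.sum_congr rfl fun i _ => by ring

theorem eq_zero_of_forall_re_mul_conj_le {z : ℂ} {K D : ℝ} (hK : 0 < K) (hD : 0 ≤ D)
    (h : ∀ c : ℂ, 2 * K * (c * starRingEnd ℂ z).re ≤ Complex.normSq c * D) : z = 0 := by
  have h' := h ((K / (D + 1) : ℝ) * z)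
  rw [mul_assoc (Complex.ofReal _), Complex.re_ofReal_mul, Complex.mul_conj, Complex.ofReal_re,
    Complex.normSq_mul, Complex.normSq_ofReal] at h'
  have hz := Complex.normSq_nonneg z
  rw [← Complex.normSq_eq_zero]
  have e : K / (D + 1) * (K / (D + 1)) * Complex.normSq z * D - 2 * K * (K / (D + 1) *
      Complex.normSq z) = - (K ^ 2 * Complex.normSq z * (D + 2) / (D + 1) ^ 2) := by
    field_simp
    ring
  have h2 : K ^ 2 * Complex.normSq z * (D + 2) / (D + 1) ^ 2 ≤ 0 := by linarith
  by_contra hne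
  have : 0 < Complex.normSq z := lt_of_le_of_ne hz (Ne.symm hne)
  have : 0 < K ^ 2 * Complex.normSq z * (D + 2) / (D + 1) ^ 2 := by positivity
  linarith

/-- The fourth-order mixed moment of an ensemble against four linear functionals, linear in the
first two and antilinear in the last two. -/
noncomputable def moment {d n : ℕ} (ψ : Fin n → Fin d → ℂ) (p : Fin n → ℝ)
    (u v w x : Fin d → ℂ) : ℂ :=
  ∑ i, p i * ((u ⬝ᵥ ψ i) * (v ⬝ᵥ ψ i) * starRingEnd ℂ (w ⬝ᵥ ψ i) * starRingEnd ℂ (x ⬝ᵥ ψ i))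

theorem MinimallyQuantum.moment_eq_zero {d n : ℕ} {ψ : Fin n → Fin d → ℂ}
    {p : Fin n → ℝ} (h : MinimallyQuantum ψ p) (hψ : ∀ i, star (ψ i) ⬝ᵥ ψ i = 1)
    (hp1 : ∑ i, p i = 1) {u w : Fin d → ℂ} (huw : star w ⬝ᵥ u = 0) :
    moment ψ p u u u w = 0 := by
  obtain rfl | hu := eq_or_ne u 0
  · simp [moment]
  have hN0 : 0 < ∑ a, Complex.normSq (u a) := by
    obtain ⟨a, ha⟩ := Function.ne_iff.mp hu
    exact Finset.sum_pos' (fun _ _ => Complex.normSq_nonneg _)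
      ⟨a, Finset.mem_univ a, Complex.normSq_pos.mpr ha⟩
  refine eq_zero_of_forall_re_mul_conj_le hN0
    (sub_nonneg.mpr (h.sum_normSq_mul_le hψ hp1 u w)) fun c => ?_
  have key := h.sum_normSq_mul_le hψ hp1 u (u + c • w)
  have hadd (z y : ℂ) : Complex.normSq (z + c * y) = Complex.normSq z +
      Complex.normSq c * Complex.normSq y + 2 * (c * (starRingEnd ℂ z * y)).re := by
    simp [Complex.normSq_apply]
    ring
  have hnorm : ∑ a, Complex.normSq ((u + c • w) a) =
      ∑ a, Complex.normSq (u a) + Complex.normSq c * ∑ a, Complex.normSq (w a) := by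
    have h0 : ∑ a, starRingEnd ℂ (u a) * w a = 0 := by
      rw [← star_eq_zero, ← huw, star_sum]
      exact Finset.sum_congr rfl fun a _ => by simp [mul_comm]
    simp only [Pi.add_apply, Pi.smul_apply, smul_eq_mul, hadd, Finset.sum_add_distrib,
      ← Finset.mul_sum, ← Complex.re_sum, h0, mul_zero, Complex.zero_re, add_zero]
  have hmom : ∑ i, p i * Complex.normSq (u ⬝ᵥ ψ i) * Complex.normSq ((u + c • w) ⬝ᵥ ψ i) =
      ∑ i, p i * Complex.normSq (u ⬝ᵥ ψ i) ^ 2 +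
        Complex.normSq c * ∑ i, p i * Complex.normSq (u ⬝ᵥ ψ i) * Complex.normSq (w ⬝ᵥ ψ i) +
        2 * (c * starRingEnd ℂ (moment ψ p u u u w)).re := by
    have hz : starRingEnd ℂ (moment ψ p u u u w) = ∑ i,
        ((p i * Complex.normSq (u ⬝ᵥ ψ i) : ℝ) : ℂ) *
          (starRingEnd ℂ (u ⬝ᵥ ψ i) * (w ⬝ᵥ ψ i)) := by
      rw [moment, map_sum]
      refine Finset.sum_congr rfl fun i _ => ?_
      simp only [map_mul, Complex.conj_conj, Complex.conj_ofReal, Complex.ofReal_mul,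
        Complex.normSq_eq_conj_mul_self]
      ring
    simp only [hz, Finset.mul_sum, Complex.re_sum, ← Finset.sum_add_distrib]
    refine Finset.sum_congr rfl fun i _ => ?_
    rw [add_dotProduct, smul_dotProduct, smul_eq_mul, hadd, mul_left_comm c (Complex.ofReal _),
      Complex.re_ofReal_mul]
    ring
  rw [hnorm, hmom] at key
  linarith

theorem moment_add_smul {d n : ℕ} (ψ : Fin n → Fin d → ℂ) (p : Fin n → ℝ)
    (u v w : Fin d → ℂ) (s : ℂ) :
    moment ψ p (u + s • v) (u + s • v) (u + s • v) w =
      moment ψ p u u u w + starRingEnd ℂ s * moment ψ p u u v w +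
      2 * s * moment ψ p u v u w + 2 * (s * starRingEnd ℂ s) * moment ψ p u v v w +
      s ^ 2 * moment ψ p v v u w + s ^ 2 * starRingEnd ℂ s * moment ψ p v v v w := by
  simp only [moment, Finset.mul_sum, ← Finset.sum_add_distrib]
  refine Finset.sum_congr rfl fun i _ => ?_
  simp only [add_dotProduct, smul_dotProduct, smul_eq_mul, map_add, map_mul]
  ring

theorem moment_eq_zero_of_orthogonal {d n : ℕ} {ψ : Fin n → Fin d → ℂ} {p : Fin n → ℝ}
    (h : ∀ u w : Fin d → ℂ, star w ⬝ᵥ u = 0 → moment ψ p u u u w = 0)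
    {u v x w : Fin d → ℂ} (hu : star w ⬝ᵥ u = 0) (hv : star w ⬝ᵥ v = 0)
    (hx : star w ⬝ᵥ x = 0) : moment ψ p u v x w = 0 := by
  have hdiag {u : Fin d → ℂ} (hu : star w ⬝ᵥ u = 0) : moment ψ p u u x w = 0 := by
    have hs (s : ℂ) := (moment_add_smul ψ p u x w s).symm.trans (h _ w (by
      rw [dotProduct_add, dotProduct_smul, hu, hx, smul_zero, add_zero]))
    have h1 := hs 1
    have h2 := hs (-1)
    have h3 := hs Complex.I
    have h4 := hs (-Complex.I)
    simp only [h u w hu, h x w hx, map_neg, map_one, Complex.conj_I] at h1 h2 h3 h4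
    linear_combination (h1 - h2) / 4 + Complex.I * (h3 - h4) / 4 +
      (moment ψ p u u x w / 2 - moment ψ p u x u w) * Complex.I_sq
  have hadd : moment ψ p (u + v) (u + v) x w = moment ψ p u u x w + 2 * moment ψ p u v x w +
      moment ψ p v v x w := by
    simp only [moment, Finset.mul_sum, ← Finset.sum_add_distrib]
    refine Finset.sum_congr rfl fun i _ => ?_
    simp only [add_dotProduct]
    ring
  have huv : star w ⬝ᵥ (u + v) = 0 := by rw [dotProduct_add, hu, hv, add_zero]
  rw [hdiag huv, hdiag hu, hdiag hv] at hadd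
  linear_combination -hadd / 2

theorem moment_swap_left {d n : ℕ} (ψ : Fin n → Fin d → ℂ) (p : Fin n → ℝ)
    (u v w x : Fin d → ℂ) : moment ψ p u v w x = moment ψ p v u w x :=
  Finset.sum_congr rfl fun i _ => by ring

theorem moment_swap_right {d n : ℕ} (ψ : Fin n → Fin d → ℂ) (p : Fin n → ℝ)
    (u v w x : Fin d → ℂ) : moment ψ p u v w x = moment ψ p u v x w :=
  Finset.sum_congr rfl fun i _ => by ring

theorem conj_moment {d n : ℕ} (ψ : Fin n → Fin d → ℂ) (p : Fin n → ℝ)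
    (u v w x : Fin d → ℂ) : starRingEnd ℂ (moment ψ p u v w x) = moment ψ p w x u v := by
  rw [moment, map_sum]
  refine Finset.sum_congr rfl fun i _ => ?_
  simp only [map_mul, Complex.conj_conj, Complex.conj_ofReal]
  ring

/-- The moments of an ensemble against the coordinate functionals. -/
noncomputable def coordMoment {d n : ℕ} (ψ : Fin n → Fin d → ℂ) (p : Fin n → ℝ)
    (a b c e : Fin d) : ℂ :=
  moment ψ p (Pi.single a 1) (Pi.single b 1) (Pi.single c 1) (Pi.single e 1)

theorem sum_smul_proj_kronecker_proj_apply {d n : ℕ} (ψ : Fin n → Fin d → ℂ) (p : Fin n → ℝ)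
    (q r : Fin d × Fin d) :
    (∑ i, (p i : ℂ) • (proj (ψ i) ⊗ₖ proj (ψ i))) q r =
      coordMoment ψ p q.1 q.2 r.1 r.2 := by
  simp only [Matrix.sum_apply, Matrix.smul_apply, kroneckerMap_apply, proj, vecMulVec_apply,
    coordMoment, moment, single_one_dotProduct, Pi.star_apply, smul_eq_mul, starRingEnd_apply]
  exact Finset.sum_congr rfl fun i _ => by ring

theorem sum_coordMoment {d n : ℕ} {ψ : Fin n → Fin d → ℂ} {p : Fin n → ℝ}
    (hψ : ∀ i, star (ψ i) ⬝ᵥ ψ i = 1) (hp1 : ∑ i, p i = 1) :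
    ∑ a, ∑ b, coordMoment ψ p a b a b = 1 := by
  have h (i : Fin n) : ∑ a, ∑ b, (p i : ℂ) * (ψ i a * ψ i b * starRingEnd ℂ (ψ i a) *
      starRingEnd ℂ (ψ i b)) = p i := by
    calc _ = (p i : ℂ) * ((star (ψ i) ⬝ᵥ ψ i) * (star (ψ i) ⬝ᵥ ψ i)) := by
          rw [dotProduct, Finset.sum_mul_sum, Finset.mul_sum]
          refine Finset.sum_congr rfl fun a _ => ?_
          rw [Finset.mul_sum]
          refine Finset.sum_congr rfl fun b _ => ?_
          simp only [Pi.star_apply, starRingEnd_apply]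
          ring
      _ = p i := by rw [hψ i, mul_one, mul_one]
  simp only [coordMoment, moment, single_one_dotProduct]
  simp_rw [Finset.sum_comm (s := (Finset.univ : Finset (Fin d)))
    (t := (Finset.univ : Finset (Fin n))), h]
  exact_mod_cast hp1

theorem star_single_dotProduct_single {d : ℕ} {a b : Fin d} (hab : a ≠ b) :
    star (Pi.single a 1 : Fin d → ℂ) ⬝ᵥ Pi.single b 1 = 0 := by
  rw [star_single_dotProduct, Pi.single_eq_of_ne hab]

section Coordinates

variable {d n : ℕ} {ψ : Fin n → Fin d → ℂ} {p : Fin n → ℝ}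

theorem coordMoment_eq_zero_of_fourth_ne
    (h : ∀ u w : Fin d → ℂ, star w ⬝ᵥ u = 0 → moment ψ p u u u w = 0)
    {a b c e : Fin d} (ha : e ≠ a) (hb : e ≠ b) (hc : e ≠ c) : coordMoment ψ p a b c e = 0 :=
  moment_eq_zero_of_orthogonal h (star_single_dotProduct_single ha)
    (star_single_dotProduct_single hb) (star_single_dotProduct_single hc)

theorem coordMoment_eq_zero_of_second_ne
    (h : ∀ u w : Fin d → ℂ, star w ⬝ᵥ u = 0 → moment ψ p u u u w = 0)
    {a b c e : Fin d} (ha : b ≠ a) (hc : b ≠ c) (he : b ≠ e) : coordMoment ψ p a b c e = 0 := by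
  rw [coordMoment, ← map_eq_zero (starRingEnd ℂ), conj_moment]
  exact coordMoment_eq_zero_of_fourth_ne h hc he ha

theorem coordMoment_pair
    (h : ∀ u w : Fin d → ℂ, star w ⬝ᵥ u = 0 → moment ψ p u u u w = 0)
    {a c : Fin d} (hac : a ≠ c) :
    coordMoment ψ p a a c c = 0 ∧ coordMoment ψ p a a a a = coordMoment ψ p c c c c ∧
      coordMoment ψ p a a a a = 2 * coordMoment ψ p a c a c := by
  have expand (t : ℂ) :
      (1 - t * starRingEnd ℂ t) * (coordMoment ψ p a a a c + 2 * t * coordMoment ψ p a c a c +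
          t ^ 2 * coordMoment ψ p c c a c) +
        starRingEnd ℂ t * (coordMoment ψ p a a c c + 2 * t * coordMoment ψ p a c c c +
          t ^ 2 * coordMoment ψ p c c c c) -
        t * (coordMoment ψ p a a a a + 2 * t * coordMoment ψ p a c a a +
          t ^ 2 * coordMoment ψ p c c a a) = 0 := by
    rw [← h (Pi.single a 1 + t • Pi.single c 1)
      (Pi.single c 1 - starRingEnd ℂ t • Pi.single a 1) ?_]
    · simp only [coordMoment, moment, Finset.mul_sum, ← Finset.sum_add_distrib,
        ← Finset.sum_sub_distrib]
      refine Finset.sum_congr rfl fun i _ => ?_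
      simp only [add_dotProduct, sub_dotProduct, smul_dotProduct, smul_eq_mul, map_add, map_sub,
        map_mul, Complex.conj_conj]
      ring
    · rw [star_sub, star_smul, sub_dotProduct, smul_dotProduct, star_single_dotProduct,
        star_single_dotProduct]
      simp [hac, hac.symm]
  have z1 : coordMoment ψ p a a a c = 0 :=
    coordMoment_eq_zero_of_fourth_ne h hac.symm hac.symm hac.symm
  have z2 : coordMoment ψ p c c a c = 0 := by
    rw [coordMoment, moment_swap_right]
    exact coordMoment_eq_zero_of_fourth_ne h hac hac hac
  have z3 : coordMoment ψ p a c c c = 0 := by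
    rw [coordMoment, moment_swap_left]
    exact coordMoment_eq_zero_of_second_ne h hac hac hac
  have z4 : coordMoment ψ p a c a a = 0 :=
    coordMoment_eq_zero_of_second_ne h hac.symm hac.symm hac.symm
  simp only [z1, z2, z3, z4] at expand
  have e1 := expand 1
  have e2 := expand Complex.I
  have e3 := expand 2
  have e4 := expand (2 * Complex.I)
  have hI : Complex.I ^ 3 = -Complex.I := by rw [pow_succ, Complex.I_sq]; ring
  simp only [map_one, map_mul, Complex.conj_I, map_ofNat] at e1 e2 e3 e4
  generalize coordMoment ψ p a a c c = P at *
  generalize coordMoment ψ p c c a a = P' at *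
  generalize coordMoment ψ p a a a a = Q at *
  generalize coordMoment ψ p c c c c = Q' at *
  generalize coordMoment ψ p a c a c = R at *
  have e2' : P + Q - Q' - P' = 0 := by
    refine (mul_eq_zero.mp ?_).resolve_left Complex.I_ne_zero
    grind
  have e4' : P + Q + 6 * R - 4 * Q' - 4 * P' = 0 := by
    refine (mul_eq_zero.mp ?_).resolve_left Complex.I_ne_zero
    grind
  grind

theorem design_of_moment_eq_zero (hψ : ∀ i, star (ψ i) ⬝ᵥ ψ i = 1) (hp1 : ∑ i, p i = 1)
    (h : ∀ u w : Fin d → ℂ, star w ⬝ᵥ u = 0 → moment ψ p u u u w = 0) :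
    ∑ i, (p i : ℂ) • (proj (ψ i) ⊗ₖ proj (ψ i)) =
      (1 / ((d : ℂ) * (d + 1))) • (1 + swapMatrix d) := by
  set κ : ℂ := 1 / ((d : ℂ) * (d + 1)) with hκ
  have hquad (a : Fin d) : coordMoment ψ p a a a a = 2 * κ := by
    obtain ⟨Q, hQ⟩ : ∃ Q, coordMoment ψ p a a a a = Q := ⟨_, rfl⟩
    have hx (x : Fin d) : coordMoment ψ p x x x x = Q := by
      obtain rfl | hxa := eq_or_ne x a
      · exact hQ
      · exact (coordMoment_pair h hxa).2.1.trans hQ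
    have hxy (x y : Fin d) :
        coordMoment ψ p x y x y = Q / 2 * (1 + if x = y then 1 else 0) := by
      split_ifs with hxy
      · subst hxy
        rw [hx]
        ring
      · linear_combination (hx x - (coordMoment_pair h hxy).2.2) / 2
    have hsum := sum_coordMoment hψ hp1
    simp only [hxy, ← Finset.mul_sum, Finset.sum_add_distrib, Finset.sum_ite_eq,
      Finset.mem_univ, if_true, Finset.sum_const, Finset.card_univ, Fintype.card_fin,
      nsmul_eq_mul, mul_one] at hsum
    have hd0 : (d : ℂ) ≠ 0 := by exact_mod_cast a.pos.ne'
    have hd1 : (d : ℂ) + 1 ≠ 0 := by exact_mod_cast d.succ_ne_zero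
    rw [hκ, hQ]
    field_simp
    linear_combination 2 * hsum
  have hpair {a b : Fin d} (hab : a ≠ b) : coordMoment ψ p a b a b = κ := by
    linear_combination (hquad a - (coordMoment_pair h hab).2.2) / 2
  ext ⟨a, b⟩ ⟨c, e⟩
  rw [sum_smul_proj_kronecker_proj_apply]
  simp only [Matrix.smul_apply, Matrix.add_apply, one_apply, swapMatrix, of_apply, Prod.mk.injEq,
    smul_eq_mul]
  by_cases hae : a = c ∧ b = e
  · obtain ⟨rfl, rfl⟩ := hae
    obtain rfl | hab := eq_or_ne a b
    · simp [hquad, mul_comm, one_add_one_eq_two]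
    · simp [hpair hab, hab]
  by_cases hcb : a = e ∧ b = c
  · obtain ⟨rfl, rfl⟩ := hcb
    have hab : a ≠ b := fun hab => hae ⟨hab, hab.symm⟩
    rw [coordMoment, moment_swap_right]
    change coordMoment ψ p a b a b = _
    simp [hab, hpair hab]
  rw [if_neg hae, if_neg hcb, add_zero, mul_zero]
  obtain rfl | hab := eq_or_ne a b
  · obtain rfl | hce := eq_or_ne c e
    · exact (coordMoment_pair h fun hac => hae ⟨hac, hac⟩).1
    · obtain rfl | hea := eq_or_ne e a
      · rw [coordMoment, moment_swap_right]
        exact coordMoment_eq_zero_of_fourth_ne h hce hce hce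
      · exact coordMoment_eq_zero_of_fourth_ne h hea hea hce.symm
  · by_cases hb : b = c ∨ b = e
    · rw [coordMoment, moment_swap_left]
      refine coordMoment_eq_zero_of_second_ne h hab ?_ ?_ <;> grind
    · push Not at hb
      exact coordMoment_eq_zero_of_second_ne h hab.symm hb.1 hb.2

end Coordinates

/-- **Theorem 2.** An ensemble is a generalized 2-design if and
only if every strategy (finite POVM `{E b}` plus reconstruction density
matrices `{σ b}`) has average fidelity at most `2/(d+1)`, i.e. iff the
ensemble achieves the minimal quantumness. -/
theorem gen_two_design_iff_minimal_quantumness {d n : ℕ}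
    (ψ : Fin n → Fin d → ℂ) (hψ : ∀ i, star (ψ i) ⬝ᵥ ψ i = 1)
    (p : Fin n → ℝ) (hp : ∀ i, 0 ≤ p i) (hp1 : ∑ i, p i = 1) :
    (∑ i, (p i : ℂ) • (proj (ψ i) ⊗ₖ proj (ψ i)) =
        (1 / ((d : ℂ) * (d + 1))) • (1 + swapMatrix d)) ↔
    (∀ (m : ℕ) (E : Fin m → Matrix (Fin d) (Fin d) ℂ)
        (σ : Fin m → Matrix (Fin d) (Fin d) ℂ),
      (∀ b, (E b).PosSemidef) → (∑ b, E b = 1) →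
      (∀ b, (σ b).PosSemidef) → (∀ b, (σ b).trace = 1) →
      ∑ b, ∑ i, p i * (proj (ψ i) * E b).trace.re * (proj (ψ i) * σ b).trace.re ≤
        2 / ((d : ℝ) + 1)) := by
  have hd : 0 < d := by
    obtain ⟨i⟩ : Nonempty (Fin n) := by
      by_contra hn
      rw [not_nonempty_iff] at hn
      simp at hp1
    refine Nat.pos_of_ne_zero ?_
    rintro rfl
    simpa using hψ i
  exact ⟨MinimallyQuantum.of_design hd, fun h => design_of_moment_eq_zero hψ hp1
    fun _ _ huw => MinimallyQuantum.moment_eq_zero h hψ hp1 huw⟩
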